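/- Let β ∈ (−1, 1), μ ∈ ℝ and t > 0. Then: (i) for every y > 0, 2(1+β) e^{2 μ y} ∫₀^∞ ∫₀^t h(t − τ; (1+β) b + y, μ) · h(τ; (1−β) b, μ) dτ db = ((1+β)/√(2π t)) · e^{−(y − μ t)²/(2 t)} · [ 1 − (μ/2) √(2π t) · e^{(y + μ t)²/(2 t)} · erfc( (y + μ t)/√(2 t) ) ]; and (ii) for every y < 0, 2(1−β) e^{−2 μ y} ∫₀^∞ ∫₀^t h(t − τ; (1+β) b, μ) · h(τ; (1−β) b − y, μ) dτ db = ((1−β)/√(2π t)) · e^{−(y + μ t)²/(2 t)} · [ 1 − (μ/2) √(2π t) · e^{(−y + μ t)²/(2 t)} · erfc( (−y + μ t)/√(2 t) ) ]. -/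

import Mathlib

open MeasureTheory Real Set Filter

/-- The auxiliary density `h(t; x, μ) = |x| / √(2π t³) · exp(−(x + μ t)² / (2t))`. -/
noncomputable def h (t x μ : ℝ) : ℝ :=
  |x| / Real.sqrt (2 * Real.pi * t ^ 3) * Real.exp (-(x + μ * t) ^ 2 / (2 * t))

/-- The complementary error function `erfc(z) = (2/√π) ∫_z^∞ e^{−u²} du`. -/
noncomputable def erfc (z : ℝ) : ℝ :=
  2 / Real.sqrt Real.pi * ∫ u in Ioi z, Real.exp (-u ^ 2)

lemma integrable_exp_neg_sq : Integrable fun u : ℝ => Real.exp (-u ^ 2) := by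
  simpa using integrable_exp_neg_mul_sq (b := 1) one_pos

lemma integral_Ioi_zero_exp_neg_sq : ∫ u in Ioi (0 : ℝ), Real.exp (-u ^ 2) = √π / 2 := by
  simpa using integral_gaussian_Ioi 1

lemma erfc_eq_one_sub (z : ℝ) :
    erfc z = 1 - 2 / √π * ∫ u in (0 : ℝ)..z, Real.exp (-u ^ 2) := by
  have key := intervalIntegral.integral_interval_add_Ioi (a := 0) (b := z)
    integrable_exp_neg_sq.integrableOn integrable_exp_neg_sq.integrableOn
  rw [integral_Ioi_zero_exp_neg_sq] at key
  have hpi : √π ≠ 0 := (Real.sqrt_pos.2 pi_pos).ne'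
  rw [erfc, eq_sub_of_add_eq' key]
  field_simp

lemma hasDerivAt_erfc (z : ℝ) : HasDerivAt erfc (-(2 / √π * Real.exp (-z ^ 2))) z := by
  have hc : Continuous fun u : ℝ => Real.exp (-u ^ 2) := by fun_prop
  rw [funext erfc_eq_one_sub]
  exact ((hc.integral_hasStrictDerivAt 0 z).hasDerivAt.const_mul (2 / √π)).const_sub 1

lemma erfc_neg (z : ℝ) : erfc (-z) = 2 - erfc z := by
  have key := intervalIntegral.integral_comp_neg (a := 0) (b := z) fun u => Real.exp (-u ^ 2)
  simp only [neg_sq, neg_zero] at key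
  rw [erfc_eq_one_sub, erfc_eq_one_sub, key, intervalIntegral.integral_symm]
  ring

lemma tendsto_erfc_atTop : Tendsto erfc atTop (nhds 0) := by
  have key := intervalIntegral_tendsto_integral_Ioi 0 integrable_exp_neg_sq.integrableOn tendsto_id
  rw [integral_Ioi_zero_exp_neg_sq] at key
  have hpi : √π ≠ 0 := (Real.sqrt_pos.2 pi_pos).ne'
  rw [funext erfc_eq_one_sub]
  have := (key.const_mul (2 / √π)).const_sub 1
  rwa [show 1 - 2 / √π * (√π / 2) = 0 by field_simp; ring] at this

lemma tendsto_erfc_atBot : Tendsto erfc atBot (nhds 2) := by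
  have := (tendsto_erfc_atTop.comp tendsto_neg_atBot_atTop).const_sub 2
  simpa [Function.comp_def, erfc_neg] using this

/-- The fundamental theorem of calculus for a monotone primitive with one-sided limits at the
endpoints; integrability of the derivative is automatic. -/
lemma integral_eq_sub_of_hasDerivAt_of_tendsto_of_nonneg {F f : ℝ → ℝ} {a b la lb : ℝ}
    (hab : a < b) (hderiv : ∀ x ∈ Ioo a b, HasDerivAt F (f x) x)
    (hf : ∀ x ∈ Ioo a b, 0 ≤ f x) (ha : Tendsto F (nhdsWithin a (Ioi a)) (nhds la))
    (hb : Tendsto F (nhdsWithin b (Iio b)) (nhds lb)) :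
    ∫ x in a..b, f x = lb - la := by
  have hFc : ContinuousOn F (Ioo a b) := fun x hx =>
    (hderiv x hx).continuousAt.continuousWithinAt
  have hcont := continuousOn_Icc_extendFrom_Ioo hFc ha hb
  have hderiv' : ∀ x ∈ Ioo a b, HasDerivAt (extendFrom (Ioo a b) F) (f x) x := fun x hx =>
    (hderiv x hx).congr_of_eventuallyEq <|
      (isOpen_Ioo.mem_nhds hx |> Filter.eventually_of_mem) fun y hy => extendFrom_extends hFc y hy
  have hint := intervalIntegral.integrableOn_deriv_of_nonneg hcont hderiv' hf
  exact intervalIntegral.integral_eq_sub_of_hasDerivAt_of_tendsto hab hderiv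
    ((intervalIntegrable_iff_integrableOn_Ioc_of_le hab.le).2 hint) ha hb

lemma hasDerivAt_div_sqrt_mul_sub {t τ : ℝ} (ht : 0 < t) (hτ : τ ∈ Ioo 0 t) (α γ : ℝ) :
    HasDerivAt (fun τ => (α * τ + γ * (t - τ)) / √(2 * t * τ * (t - τ)))
      (t ^ 2 * (α * τ - γ * (t - τ)) / √(2 * t * τ * (t - τ)) ^ 3) τ := by
  have hq : 0 < t - τ := sub_pos.2 hτ.2
  have hp : 0 < τ := hτ.1
  have hpos : 0 < 2 * t * τ * (t - τ) := by positivity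
  have hsq := Real.sq_sqrt hpos.le
  have hr : 0 < √(2 * t * τ * (t - τ)) := Real.sqrt_pos.2 hpos
  have hsub : HasDerivAt (fun τ => t - τ) (-1) τ := (hasDerivAt_id τ).const_sub t
  have hrad := (((hasDerivAt_id τ).const_mul (2 * t)).mul hsub).sqrt hpos.ne'
  have hnum := ((hasDerivAt_id τ).const_mul α).add (hsub.const_mul γ)
  refine (hnum.div hrad hr.ne').congr_deriv ?_
  simp only [id, Pi.mul_apply, Pi.add_apply]
  generalize √(2 * t * τ * (t - τ)) = r at *
  field_simp
  rw [hsq]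
  ring

lemma tendsto_inv_sqrt_mul_sub_left {t : ℝ} (ht : 0 < t) :
    Tendsto (fun τ => (√(2 * t * τ * (t - τ)))⁻¹) (nhdsWithin 0 (Ioi 0)) atTop := by
  refine tendsto_inv_nhdsGT_zero.comp (tendsto_nhdsWithin_iff.2 ⟨?_, ?_⟩)
  · have hc : Continuous fun τ => √(2 * t * τ * (t - τ)) := by fun_prop
    simpa using (hc.tendsto 0).mono_left nhdsWithin_le_nhds
  · filter_upwards [Ioo_mem_nhdsGT ht] with τ hτ
    have hp := hτ.1
    have hq := sub_pos.2 hτ.2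
    exact Real.sqrt_pos.2 (by positivity)

lemma tendsto_inv_sqrt_mul_sub_right {t : ℝ} (ht : 0 < t) :
    Tendsto (fun τ => (√(2 * t * τ * (t - τ)))⁻¹) (nhdsWithin t (Iio t)) atTop := by
  refine tendsto_inv_nhdsGT_zero.comp (tendsto_nhdsWithin_iff.2 ⟨?_, ?_⟩)
  · have hc : Continuous fun τ => √(2 * t * τ * (t - τ)) := by fun_prop
    simpa using (hc.tendsto t).mono_left nhdsWithin_le_nhds
  · filter_upwards [Ioo_mem_nhdsLT ht] with τ hτ
    have hp := hτ.1
    have hq := sub_pos.2 hτ.2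
    exact Real.sqrt_pos.2 (by positivity)

lemma sqrt_mul_sqrt_two_pi_cube {t p q : ℝ} (ht : 0 < t) (hp : 0 < p) (hq : 0 < q) :
    √(2 * π * q ^ 3) * √(2 * π * p ^ 3) * (2 * t ^ 3) =
      √(2 * π * t ^ 3) * √π * √(2 * t * p * q) ^ 3 := by
  have hπ := pi_pos
  refine (pow_left_inj₀ (by positivity) (by positivity) two_ne_zero).1 ?_
  rw [mul_pow, mul_pow, mul_pow (_ * _), mul_pow √(2 * π * t ^ 3), pow_right_comm _ 3 2,
    Real.sq_sqrt (by positivity), Real.sq_sqrt (by positivity), Real.sq_sqrt (by positivity),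
    Real.sq_sqrt (by positivity), Real.sq_sqrt (by positivity)]
  ring

lemma h_nonneg (t x μ : ℝ) : 0 ≤ h t x μ := by
  unfold h
  positivity

/-- The densities `h(·; x, μ)` of first passage times form a convolution semigroup in `x`. -/
lemma integral_h_mul_h {t a c : ℝ} (ht : 0 < t) (ha : 0 < a) (hc : 0 < c) (μ : ℝ) :
    ∫ τ in (0 : ℝ)..t, h (t - τ) a μ * h τ c μ = h t (a + c) μ := by
  set r : ℝ → ℝ := fun τ => √(2 * t * τ * (t - τ))
  set W : ℝ → ℝ := fun τ => (a * τ + -c * (t - τ)) / r τ with hW_def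
  set V : ℝ → ℝ := fun τ => (a * τ + c * (t - τ)) / r τ with hV_def
  set K : ℝ := Real.exp (-(a + c + μ * t) ^ 2 / (2 * t)) / (2 * √(2 * π * t ^ 3)) with hK
  set F : ℝ → ℝ := fun τ => -K *
    ((a + c) * erfc (W τ) + (c - a) * Real.exp (2 * a * c / t) * erfc (V τ))
  have hlin (α γ : ℝ) : Continuous fun τ => α * τ + γ * (t - τ) := by fun_prop
  have hlin0 (α γ : ℝ) : Tendsto (fun τ => α * τ + γ * (t - τ))
      (nhdsWithin 0 (Ioi 0)) (nhds (γ * t)) := by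
    simpa using ((hlin α γ).tendsto 0).mono_left nhdsWithin_le_nhds
  have hlint (α γ : ℝ) : Tendsto (fun τ => α * τ + γ * (t - τ))
      (nhdsWithin t (Iio t)) (nhds (α * t)) := by
    simpa using ((hlin α γ).tendsto t).mono_left nhdsWithin_le_nhds
  have hW0 : Tendsto W (nhdsWithin 0 (Ioi 0)) atBot :=
    (hlin0 a (-c)).neg_mul_atTop (by nlinarith) (tendsto_inv_sqrt_mul_sub_left ht)
  have hV0 : Tendsto V (nhdsWithin 0 (Ioi 0)) atTop :=
    (hlin0 a c).pos_mul_atTop (by positivity) (tendsto_inv_sqrt_mul_sub_left ht)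
  have hWt : Tendsto W (nhdsWithin t (Iio t)) atTop :=
    (hlint a (-c)).pos_mul_atTop (by positivity) (tendsto_inv_sqrt_mul_sub_right ht)
  have hVt : Tendsto V (nhdsWithin t (Iio t)) atTop :=
    (hlint a c).pos_mul_atTop (by positivity) (tendsto_inv_sqrt_mul_sub_right ht)
  have hF0 := (((tendsto_erfc_atBot.comp hW0).const_mul (a + c)).add
    ((tendsto_erfc_atTop.comp hV0).const_mul ((c - a) * Real.exp (2 * a * c / t)))).const_mul (-K)
  have hFt := (((tendsto_erfc_atTop.comp hWt).const_mul (a + c)).add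
    ((tendsto_erfc_atTop.comp hVt).const_mul ((c - a) * Real.exp (2 * a * c / t)))).const_mul (-K)
  have hderiv : ∀ τ ∈ Ioo 0 t, HasDerivAt F (h (t - τ) a μ * h τ c μ) τ := by
    intro τ hτ
    have hp : 0 < τ := hτ.1
    have hq : 0 < t - τ := sub_pos.2 hτ.2
    have hpos : 0 < 2 * t * τ * (t - τ) := by positivity
    have hr : 0 < r τ := Real.sqrt_pos.2 hpos
    have hr2 : r τ ^ 2 = 2 * t * τ * (t - τ) := Real.sq_sqrt hpos.le
    have hWd := (hasDerivAt_erfc (W τ)).comp τ (hasDerivAt_div_sqrt_mul_sub ht hτ a (-c))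
    have hVd := (hasDerivAt_erfc (V τ)).comp τ (hasDerivAt_div_sqrt_mul_sub ht hτ a c)
    refine (((hWd.const_mul (a + c)).add (hVd.const_mul
      ((c - a) * Real.exp (2 * a * c / t)))).const_mul (-K)).congr_deriv ?_
    change _ * (_ * (_ * (_ / r τ ^ 3)) + _ * (_ * (_ / r τ ^ 3))) = _
    have hVW : Real.exp (2 * a * c / t) * Real.exp (-V τ ^ 2) = Real.exp (-W τ ^ 2) := by
      rw [← Real.exp_add]
      congr 1
      simp only [hV_def, hW_def, div_pow, hr2]
      field_simp
      ring
    have hexp : Real.exp (-(a + c + μ * t) ^ 2 / (2 * t)) * Real.exp (-W τ ^ 2) =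
        Real.exp (-(a + μ * (t - τ)) ^ 2 / (2 * (t - τ))) *
          Real.exp (-(c + μ * τ) ^ 2 / (2 * τ)) := by
      rw [← Real.exp_add, ← Real.exp_add]
      congr 1
      simp only [hW_def, div_pow, hr2]
      field_simp
      ring
    have hroot := sqrt_mul_sqrt_two_pi_cube ht hp hq
    change _ = _ * r τ ^ 3 at hroot
    have hπ := pi_pos
    have h1 : 0 < √(2 * π * (t - τ) ^ 3) := Real.sqrt_pos.2 (by positivity)
    have h2 : 0 < √(2 * π * τ ^ 3) := Real.sqrt_pos.2 (by positivity)
    have h3 : 0 < √(2 * π * t ^ 3) := Real.sqrt_pos.2 (by positivity)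
    have h4 : 0 < √π := Real.sqrt_pos.2 hπ
    have hcoef : 2 * a * c * t ^ 3 / (√(2 * π * t ^ 3) * √π * r τ ^ 3) =
        a * c / (√(2 * π * (t - τ) ^ 3) * √(2 * π * τ ^ 3)) := by
      rw [← hroot]
      field_simp
    calc _ = K * (2 / √π) * t ^ 2 / r τ ^ 3 * ((a + c) * (a * τ + c * (t - τ)) *
            Real.exp (-W τ ^ 2) + (c - a) * (a * τ - c * (t - τ)) *
            (Real.exp (2 * a * c / t) * Real.exp (-V τ ^ 2))) := by ring
      _ = 2 * a * c * t ^ 3 / (√(2 * π * t ^ 3) * √π * r τ ^ 3) *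
            (Real.exp (-(a + c + μ * t) ^ 2 / (2 * t)) * Real.exp (-W τ ^ 2)) := by
          rw [hVW, hK]
          field_simp
          ring
      _ = _ := by
          rw [hcoef, hexp, h, h, abs_of_pos ha, abs_of_pos hc]
          field_simp
  rw [integral_eq_sub_of_hasDerivAt_of_tendsto_of_nonneg ht hderiv
    (fun τ _ => mul_nonneg (h_nonneg _ _ _) (h_nonneg _ _ _)) hF0 hFt, h,
    abs_of_pos (add_pos ha hc), hK]
  have h3 : 0 < √(2 * π * t ^ 3) := Real.sqrt_pos.2 (by have := pi_pos; positivity)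
  field_simp
  ring

lemma integral_Ioi_h {t y : ℝ} (ht : 0 < t) (hy : 0 < y) (μ : ℝ) :
    2 * ∫ b in Ioi (0 : ℝ), h t (2 * b + y) μ =
      1 / √(2 * π * t) * Real.exp (-(y + μ * t) ^ 2 / (2 * t)) -
        μ / 2 * erfc ((y + μ * t) / √(2 * t)) := by
  have hπ := pi_pos
  have hs : 0 < √(2 * t) := Real.sqrt_pos.2 (by positivity)
  have hs2 : √(2 * t) ^ 2 = 2 * t := Real.sq_sqrt (by positivity)
  have hp : 0 < √π := Real.sqrt_pos.2 hπ
  have hpt : √(2 * π * t) = √π * √(2 * t) := by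
    rw [← Real.sqrt_mul hπ.le]; ring_nf
  have hpt3 : √(2 * π * t ^ 3) = √π * √(2 * t) * t := by
    rw [← hpt, ← Real.sqrt_sq ht.le, ← Real.sqrt_mul (by positivity), Real.sqrt_sq ht.le]
    ring_nf
  set z : ℝ → ℝ := fun b => (2 * b + y + μ * t) / √(2 * t) with hz
  have hzd (b : ℝ) : HasDerivAt z (2 / √(2 * t)) b := by
    exact (((((hasDerivAt_id b).const_mul 2).add_const y).add_const (μ * t)).div_const
      √(2 * t)).congr_deriv (by rw [mul_one])
  have hzsq (b : ℝ) : -z b ^ 2 = -(2 * b + y + μ * t) ^ 2 / (2 * t) := by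
    rw [hz, div_pow, hs2, neg_div]
  have hzt : Tendsto z atTop atTop := by
    refine Tendsto.atTop_div_const hs ?_
    exact tendsto_atTop_add_const_right _ _ (tendsto_atTop_add_const_right _ _
      (tendsto_id.const_mul_atTop two_pos))
  have hderiv (b : ℝ) (hb : b ∈ Ici (0 : ℝ)) :
      HasDerivAt (fun b => μ / 4 * erfc (z b) - 1 / (2 * √(2 * π * t)) * Real.exp (-z b ^ 2))
        (h t (2 * b + y) μ) b := by
    have hb' : 0 < 2 * b + y := by have : 0 ≤ b := hb; linarith
    refine ((((hasDerivAt_erfc (z b)).comp b (hzd b)).const_mul (μ / 4)).sub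
      (((hzd b).pow 2).neg.exp.const_mul (1 / (2 * √(2 * π * t))))).congr_deriv ?_
    have hz' : z b * √(2 * t) = 2 * b + y + μ * t := by
      rw [hz]; field_simp
    rw [h, ← hzsq, abs_of_pos hb', hpt, hpt3]
    simp only [Pi.neg_apply, Pi.pow_apply]
    have : 2 * b + y = z b * √(2 * t) - μ * t := by rw [hz']; ring
    rw [this]
    generalize z b = w
    generalize √(2 * t) = s at *
    generalize Real.exp _ = e
    field_simp
    have ht' : t = s ^ 2 / 2 := by rw [hs2]; ring
    rw [ht']
    ring
  have hlim : Tendsto (fun b => μ / 4 * erfc (z b) - 1 / (2 * √(2 * π * t)) * Real.exp (-z b ^ 2))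
      atTop (nhds (μ / 4 * 0 - 1 / (2 * √(2 * π * t)) * 0)) := by
    refine ((tendsto_erfc_atTop.comp hzt).const_mul _).sub (Tendsto.const_mul _ ?_)
    exact Real.tendsto_exp_atBot.comp
      (tendsto_neg_atTop_atBot.comp ((tendsto_pow_atTop two_ne_zero).comp hzt))
  rw [integral_Ioi_of_hasDerivAt_of_nonneg' hderiv (fun b _ => h_nonneg _ _ _) hlim, hzsq]
  simp only [hz, mul_zero, zero_add]
  ring

/-- Case `y > 0`, after the inner convolution integral has been evaluated. -/
lemma exp_mul_integral_Ioi_h {β μ t y : ℝ} (ht : 0 < t) (hy : 0 < y) :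
    2 * (1 + β) * Real.exp (2 * μ * y) * ∫ b in Ioi (0 : ℝ), h t (2 * b + y) μ
      = (1 + β) / √(2 * π * t) * Real.exp (-(y - μ * t) ^ 2 / (2 * t)) *
          (1 - μ / 2 * √(2 * π * t) * Real.exp ((y + μ * t) ^ 2 / (2 * t)) *
            erfc ((y + μ * t) / √(2 * t))) := by
  have hs : 0 < √(2 * π * t) := Real.sqrt_pos.2 (by have := pi_pos; positivity)
  have h1 : Real.exp (2 * μ * y) * Real.exp (-(y + μ * t) ^ 2 / (2 * t)) =
      Real.exp (-(y - μ * t) ^ 2 / (2 * t)) := by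
    rw [← Real.exp_add]
    congr 1
    field_simp
    ring
  have h2 : Real.exp (-(y - μ * t) ^ 2 / (2 * t)) * Real.exp ((y + μ * t) ^ 2 / (2 * t)) =
      Real.exp (2 * μ * y) := by
    rw [← Real.exp_add]
    congr 1
    field_simp
    ring
  calc _ = (1 + β) * Real.exp (2 * μ * y) * (2 * ∫ b in Ioi (0 : ℝ), h t (2 * b + y) μ) := by ring
    _ = (1 + β) / √(2 * π * t) * (Real.exp (2 * μ * y) * Real.exp (-(y + μ * t) ^ 2 / (2 * t))) -
        (1 + β) * (μ / 2) * Real.exp (2 * μ * y) * erfc ((y + μ * t) / √(2 * t)) := by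
      rw [integral_Ioi_h ht hy]
      ring
    _ = _ := by
      rw [h1, ← h2]
      field_simp

/-- Transition density of skew Brownian motion with alternating drifts `μ₊ = μ`, `μ₋ = −μ`
(skew level 0, start at 0): case `y > 0` and case `y < 0`. -/
theorem sbm_alternating_drift_density (β μ t : ℝ)
    (hβ : β ∈ Ioo (-1 : ℝ) 1) (ht : 0 < t) :
    (∀ y : ℝ, 0 < y →
      2 * (1 + β) * Real.exp (2 * μ * y) *
          ∫ b in Ioi (0 : ℝ), ∫ τ in (0 : ℝ)..t,
            h (t - τ) ((1 + β) * b + y) μ * h τ ((1 - β) * b) μ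
        = (1 + β) / Real.sqrt (2 * Real.pi * t) * Real.exp (-(y - μ * t) ^ 2 / (2 * t)) *
            (1 - μ / 2 * Real.sqrt (2 * Real.pi * t) *
              Real.exp ((y + μ * t) ^ 2 / (2 * t)) *
                erfc ((y + μ * t) / Real.sqrt (2 * t)))) ∧
    (∀ y : ℝ, y < 0 →
      2 * (1 - β) * Real.exp (-(2 * μ * y)) *
          ∫ b in Ioi (0 : ℝ), ∫ τ in (0 : ℝ)..t,
            h (t - τ) ((1 + β) * b) μ * h τ ((1 - β) * b - y) μ
        = (1 - β) / Real.sqrt (2 * Real.pi * t) * Real.exp (-(y + μ * t) ^ 2 / (2 * t)) *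
            (1 - μ / 2 * Real.sqrt (2 * Real.pi * t) *
              Real.exp ((-y + μ * t) ^ 2 / (2 * t)) *
                erfc ((-y + μ * t) / Real.sqrt (2 * t)))) := by
  have hβ₁ : 0 < 1 + β := by linarith [hβ.1]
  have hβ₂ : 0 < 1 - β := by linarith [hβ.2]
  refine ⟨fun y hy => ?_, fun y hy => ?_⟩
  · rw [← exp_mul_integral_Ioi_h ht hy]
    congr 1
    refine setIntegral_congr_fun measurableSet_Ioi fun b (hb : 0 < b) => ?_
    have := integral_h_mul_h ht (a := (1 + β) * b + y) (c := (1 - β) * b)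
      (by positivity) (by positivity) μ
    simp only [this]
    ring_nf
  · have hy' : 0 < -y := neg_pos.2 hy
    have key := exp_mul_integral_Ioi_h (β := -β) (μ := μ) ht hy'
    rw [show (-y - μ * t) ^ 2 = (y + μ * t) ^ 2 by ring, ← sub_eq_add_neg,
      show 2 * μ * -y = -(2 * μ * y) by ring] at key
    rw [← key]
    congr 1
    refine setIntegral_congr_fun measurableSet_Ioi fun b (hb : 0 < b) => ?_
    have := integral_h_mul_h ht (a := (1 + β) * b) (c := (1 - β) * b - y)
      (by positivity) (by linarith [mul_pos hβ₂ hb]) μ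
    simp only [this]
    ring_nf
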